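/- Let (A^1, A^2, r^1, r^2) be a zero-sum two-player finite normal-form game (r^2 = −r^1), η > 0, and μ̄ an interior strategy profile. Define the policy-dependent transformed payoffs r^i_π(a^i, a^{-i}) = r^i evaluated at the action pair − η log(π^i(a^i)/μ̄^i(a^i)) + η log(π^{-i}(a^{-i})/μ̄^{-i}(a^{-i})), with transformed values Ṽ^i(π) = V^i(π) − η·KL(π^i, μ̄^i) + η·KL(π^{-i}, μ̄^{-i}). Let π* be an interior Nash equilibrium of the transformed game, and let t ↦ y_t be differentiable FoReL dynamics: π_t^i = softmax(y_t^i) and d/dt y_t^i(a) = Σ_{a^{-i}} π_t^{-i}(a^{-i}) r^i_{π_t}(a, a^{-i}). Then for all t ≥ 0, d/dt J_{π*}(y_t) ≤ −η Σ_{i=1}^2 KL(π*^i, π_t^i). -/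

import Mathlib

open Finset

/-- A probability vector on a finite set: nonnegative entries summing to 1. -/
def IsMixed {α : Type*} [Fintype α] (p : α → ℝ) : Prop :=
  (∀ a, 0 ≤ p a) ∧ ∑ a, p a = 1

/-- A strictly positive (interior) vector. -/
def IsInterior {α : Type*} [Fintype α] (p : α → ℝ) : Prop :=
  ∀ a, 0 < p a

/-- Kullback–Leibler divergence `KL(p, q) = Σ_a p(a) log(p(a)/q(a))`. -/
noncomputable def KL {α : Type*} [Fintype α] (p q : α → ℝ) : ℝ :=
  ∑ a, p a * Real.log (p a / q a)

/-- `softmax(y)(a) = exp(y(a)) / Σ_b exp(y(b))`. -/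
noncomputable def softmax {α : Type*} [Fintype α] (y : α → ℝ) (a : α) : ℝ :=
  Real.exp (y a) / ∑ b, Real.exp (y b)

/-- Expected payoff in a two-player finite normal-form game. -/
noncomputable def val2 {A B : Type*} [Fintype A] [Fintype B]
    (r : A → B → ℝ) (p : A → ℝ) (q : B → ℝ) : ℝ :=
  ∑ a, ∑ b, p a * q b * r a b

lemma softmax_pos {α : Type*} [Fintype α] [Nonempty α] (y : α → ℝ) (a : α) :
    0 < softmax y a :=
  div_pos (Real.exp_pos _) (sum_pos (fun _ _ => Real.exp_pos _) univ_nonempty)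

lemma sum_softmax {α : Type*} [Fintype α] [Nonempty α] (y : α → ℝ) :
    ∑ a, softmax y a = 1 := by
  have h : 0 < ∑ b, Real.exp (y b) := sum_pos (fun _ _ => Real.exp_pos _) univ_nonempty
  simp only [softmax, ← sum_div]
  exact div_self h.ne'

lemma isMixed_softmax {α : Type*} [Fintype α] [Nonempty α] (y : α → ℝ) :
    IsMixed (softmax y) :=
  ⟨fun a => (softmax_pos y a).le, sum_softmax y⟩

lemma hasDerivAt_log_sum_exp_sub {α : Type*} [Fintype α] [Nonempty α]
    {y : ℝ → α → ℝ} {g : α → ℝ} {t : ℝ} (s : α → ℝ)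
    (hy : ∀ a, HasDerivAt (fun τ => y τ a) (g a) t) :
    HasDerivAt (fun τ => Real.log (∑ a, Real.exp (y τ a)) - ∑ a, s a * y τ a)
      (∑ a, (softmax (y t) a - s a) * g a) t := by
  have h : 0 < ∑ b, Real.exp (y t b) := sum_pos (fun _ _ => Real.exp_pos _) univ_nonempty
  have h1 : HasDerivAt (fun τ => ∑ a, Real.exp (y τ a)) (∑ a, Real.exp (y t a) * g a) t :=
    HasDerivAt.fun_sum fun a _ => (hy a).exp
  have h2 : HasDerivAt (fun τ => ∑ a, s a * y τ a) (∑ a, s a * g a) t :=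
    HasDerivAt.fun_sum fun a _ => (hy a).const_mul (s a)
  refine ((h1.log h.ne').sub h2).congr_deriv ?_
  rw [sum_div, ← sum_sub_distrib]
  refine sum_congr rfl fun a _ => ?_
  simp only [softmax]
  ring

lemma sum_sub_mul_log_div {α : Type*} [Fintype α] {p s m : α → ℝ}
    (hp : IsInterior p) (hs : IsInterior s) (hm : IsInterior m) :
    ∑ a, (p a - s a) * Real.log (p a / m a) = KL p m - KL s m + KL s p := by
  simp only [KL]
  rw [← sum_sub_distrib, ← sum_add_distrib]
  refine sum_congr rfl fun a _ => ?_
  rw [Real.log_div (hp a).ne' (hm a).ne', Real.log_div (hs a).ne' (hm a).ne',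
    Real.log_div (hs a).ne' (hp a).ne']
  ring

lemma sum_sub_mul_sum_transformed {α β : Type*} [Fintype α] [Fintype β]
    {p s : α → ℝ} {q : β → ℝ} (hp : ∑ a, p a = 1) (hs : ∑ a, s a = 1) (hq : ∑ b, q b = 1)
    (R : α → β → ℝ) (η : ℝ) (u : α → ℝ) (v : β → ℝ) :
    ∑ a, (p a - s a) * ∑ b, q b * (R a b - η * u a + η * v b) =
      val2 R p q - val2 R s q - η * ∑ a, (p a - s a) * u a := by
  have h : ∀ a, ∑ b, q b * (R a b - η * u a + η * v b) =
      ∑ b, q b * R a b - η * u a + ∑ b, q b * (η * v b) := by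
    intro a
    simp only [mul_add, mul_sub, sum_add_distrib, sum_sub_distrib, ← sum_mul, hq, one_mul]
  have hc : ∑ a, (p a - s a) * ∑ b, q b * (η * v b) = 0 := by
    rw [← sum_mul, sum_sub_distrib, hp, hs, sub_self, zero_mul]
  have hv : ∀ p' : α → ℝ, val2 R p' q = ∑ a, p' a * ∑ b, q b * R a b := by
    intro p'
    simp only [val2, mul_sum, mul_assoc]
  simp only [h]
  simp only [mul_add, sum_add_distrib, hc, hv]
  rw [mul_sum, ← sum_sub_distrib, ← sum_sub_distrib, add_zero]
  refine sum_congr rfl fun a _ => ?_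
  ring

lemma val2_neg_swap {α β : Type*} [Fintype α] [Fintype β]
    (r : α → β → ℝ) (p : α → ℝ) (q : β → ℝ) :
    val2 (fun b a => - r a b) q p = - val2 r p q := by
  simp only [val2, ← sum_neg_distrib]
  rw [sum_comm]
  refine sum_congr rfl fun a _ => sum_congr rfl fun b _ => ?_
  ring

/-- For the zero-sum reward transformation
`r^i_π = r^i − η log(π^i/μ̄^i) + η log(π^{-i}/μ̄^{-i})`, FoReL dynamics make
`J_{π*}` decrease at rate at least `η Σ_i KL(π*^i, π_t^i)`, where `π*` is an
interior Nash equilibrium of the transformed game. -/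
theorem deriv_J_le_neg_eta_KL_zero_sum_transform
    {A B : Type*} [Fintype A] [Fintype B] [Nonempty A] [Nonempty B]
    (r : A → B → ℝ) (η : ℝ) (hη : 0 < η)
    (m1 : A → ℝ) (m2 : B → ℝ)
    (hm1 : IsMixed m1) (hm1I : IsInterior m1) (hm2 : IsMixed m2) (hm2I : IsInterior m2)
    (s1 : A → ℝ) (s2 : B → ℝ)
    (hs1 : IsMixed s1) (hs1I : IsInterior s1) (hs2 : IsMixed s2) (hs2I : IsInterior s2)
    (hN1 : ∀ p : A → ℝ, IsMixed p →
      val2 r p s2 - η * KL p m1 + η * KL s2 m2 ≤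
        val2 r s1 s2 - η * KL s1 m1 + η * KL s2 m2)
    (hN2 : ∀ q : B → ℝ, IsMixed q →
      (- val2 r s1 q) - η * KL q m2 + η * KL s1 m1 ≤
        (- val2 r s1 s2) - η * KL s2 m2 + η * KL s1 m1)
    (y1 : ℝ → A → ℝ) (y2 : ℝ → B → ℝ)
    (hy1 : ∀ t a, HasDerivAt (fun s => y1 s a)
      (∑ b, softmax (y2 t) b *
        (r a b - η * Real.log (softmax (y1 t) a / m1 a)
          + η * Real.log (softmax (y2 t) b / m2 b))) t)
    (hy2 : ∀ t b, HasDerivAt (fun s => y2 s b)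
      (∑ a, softmax (y1 t) a *
        (- r a b - η * Real.log (softmax (y2 t) b / m2 b)
          + η * Real.log (softmax (y1 t) a / m1 a))) t) :
    ∀ t ≥ (0 : ℝ), ∃ d : ℝ,
      HasDerivAt (fun s =>
        (Real.log (∑ a, Real.exp (y1 s a)) - ∑ a, s1 a * y1 s a) +
        (Real.log (∑ b, Real.exp (y2 s b)) - ∑ b, s2 b * y2 s b)) d t ∧
      d ≤ - η * (KL s1 (softmax (y1 t)) + KL s2 (softmax (y2 t))) := by
  intro t _
  refine ⟨_, (hasDerivAt_log_sum_exp_sub s1 (hy1 t)).add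
    (hasDerivAt_log_sum_exp_sub s2 (hy2 t)), ?_⟩
  have hp := isMixed_softmax (y1 t)
  have hq := isMixed_softmax (y2 t)
  have e1 := sum_sub_mul_sum_transformed hp.2 hs1.2 hq.2 r η
    (fun a => Real.log (softmax (y1 t) a / m1 a)) (fun b => Real.log (softmax (y2 t) b / m2 b))
  have e2 := sum_sub_mul_sum_transformed hq.2 hs2.2 hp.2 (fun b a => - r a b) η
    (fun b => Real.log (softmax (y2 t) b / m2 b)) (fun a => Real.log (softmax (y1 t) a / m1 a))
  rw [sum_sub_mul_log_div (softmax_pos (y1 t)) hs1I hm1I] at e1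
  rw [sum_sub_mul_log_div (softmax_pos (y2 t)) hs2I hm2I, val2_neg_swap, val2_neg_swap] at e2
  rw [e1, e2]
  linarith [hN1 _ hp, hN2 _ hq]
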